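/- arXiv:1903.02933 — 2 statements merged into one kernel-verified Lean document; each statement's English description precedes it below -/
import Mathlib

section
/- Let C_rand be a uniformly random k-dimensional subspace of F_{q^m}^n with s < k. For every non-negative integer a, P( dim_{F_{q^m}} (C_rand + C_rand^{[1]} + ... + C_rand^{[s]}) ≤ min(n, (s+1)k) − a ) = O(q^{−ma}), where the implied constant is independent of m and a. -/
open Module Polynomial

def frobV {L : Type*} [Field L] (q s : ℕ) {n : ℕ} (v : Fin n → L) : Fin n → L :=
  fun i => v i ^ q ^ s

/-- The Gabidulin code of dimension `k` with support vector `a`: evaluations of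
`q`-polynomials of `q`-degree `< k`, i.e. the span of the Frobenius powers of `a`. -/
def gab {L : Type*} [Field L] (q k : ℕ) {n : ℕ} (a : Fin n → L) : Submodule L (Fin n → L) :=
  Submodule.span L {v : Fin n → L | ∃ j < k, v = frobV q j a}

/-- Componentwise `q^s`-power Frobenius image of a code. -/
def frobCode {L : Type*} [Field L] (q s : ℕ) {n : ℕ} (C : Submodule L (Fin n → L)) :
    Submodule L (Fin n → L) :=
  Submodule.span L (frobV q s '' (C : Set (Fin n → L)))

/-- Dual code with respect to the standard bilinear form. -/
def dualCode {L : Type*} [Field L] {n : ℕ} (C : Submodule L (Fin n → L)) :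
    Submodule L (Fin n → L) where
  carrier := {x | ∀ c ∈ C, ∑ i, x i * c i = 0}
  add_mem' := by
    intro a b ha hb c hc
    simp only [Set.mem_setOf_eq] at *
    simp [add_mul, Finset.sum_add_distrib, ha c hc, hb c hc]
  zero_mem' := by intro c hc; simp
  smul_mem' := by
    intro r x hx c hc
    simp only [Set.mem_setOf_eq] at *
    simp [smul_eq_mul, mul_assoc, ← Finset.mul_sum, hx c hc]

section Counting

theorem sum_card_subtype_comm {α β : Type*} [Fintype α] [Fintype β] (r : α → β → Prop) :
    ∑ a, Nat.card {b // r a b} = ∑ b, Nat.card {a // r a b} := by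
  classical
  simp only [Nat.card_eq_fintype_card, Fintype.card_subtype]
  exact Finset.sum_card_bipartiteAbove_eq_sum_card_bipartiteBelow r

theorem pow_mul_le_two_mul_prod_sub (Q n k : ℕ) (hQ : 3 ≤ Q) (hk : k ≤ n) :
    (Q : ℝ) ^ (n * k) ≤ 2 * ∏ i : Fin k, ((Q : ℝ) ^ n - (Q : ℝ) ^ (i : ℕ)) := by
  have hQ' : (3 : ℝ) ≤ Q := by exact_mod_cast hQ
  have key : ∀ j ≤ n, (Q : ℝ) ^ (n * j) * (2 * (Q : ℝ) ^ n - (Q : ℝ) ^ j) ≤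
      2 * (Q : ℝ) ^ n * ∏ i ∈ Finset.range j, ((Q : ℝ) ^ n - (Q : ℝ) ^ i) := by
    intro j
    induction j with
    | zero => intro _; simp
    | succ j ih =>
      intro hj
      have hle : (Q : ℝ) ^ j ≤ (Q : ℝ) ^ n := pow_le_pow_right₀ (by linarith) (by omega)
      rw [Finset.prod_range_succ, ← mul_assoc]
      refine le_trans ?_ (mul_le_mul_of_nonneg_right (ih (by omega)) (by linarith))
      rw [Nat.mul_succ, pow_add, mul_assoc, mul_assoc]
      refine mul_le_mul_of_nonneg_left ?_ (by positivity)
      have hpos : 0 < (Q : ℝ) ^ j := by positivity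
      have hpos' : 0 < (Q : ℝ) ^ n := by positivity
      rw [pow_succ]
      nlinarith [mul_le_mul_of_nonneg_left hQ' (mul_pos hpos hpos').le, sq_nonneg ((Q : ℝ) ^ j)]
  have hpos : 0 < (Q : ℝ) ^ n := by positivity
  have hle : (Q : ℝ) ^ k ≤ (Q : ℝ) ^ n := pow_le_pow_right₀ (by linarith) hk
  have hpos' : 0 < (Q : ℝ) ^ (n * k) := by positivity
  rw [Fin.prod_univ_eq_prod_range (fun i => (Q : ℝ) ^ n - (Q : ℝ) ^ i)]
  nlinarith [key k hk]

theorem sum_pow_mul_pow_le (Q k s : ℕ) (hQ : 2 ≤ Q) (hs : 1 ≤ s) (hsk : s < k) :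
    ∑ r ∈ Finset.range (s + 1), Q ^ (2 * r) * (Q ^ (s + 1 - r)) ^ k ≤ 2 * Q ^ ((s + 1) * k) := by
  have hexp : ∀ r ∈ Finset.range (s + 1),
      Q ^ (2 * r) * (Q ^ (s + 1 - r)) ^ k * Q ^ (r * (k - 2)) = Q ^ ((s + 1) * k) := by
    intro r hr
    obtain ⟨t, rfl⟩ : ∃ t, s = r + t :=
      ⟨s - r, by have := Finset.mem_range.1 hr; omega⟩
    obtain ⟨u, rfl⟩ : ∃ u, k = u + 2 := ⟨k - 2, by omega⟩
    rw [← pow_mul, ← pow_add, ← pow_add, show r + t + 1 - r = t + 1 by omega, Nat.add_sub_cancel]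
    congr 1
    ring
  rcases Nat.lt_or_ge k 3 with h3 | h3
  · obtain rfl : s = 1 := by omega
    obtain rfl : k = 2 := by omega
    simp [Finset.sum_range_succ]
    ring_nf
    rfl
  · have hterm : ∀ r ∈ Finset.range (s + 1),
        ((Q ^ (2 * r) * (Q ^ (s + 1 - r)) ^ k : ℕ) : ℝ) ≤
          (Q : ℝ) ^ ((s + 1) * k) * (1 / 2) ^ r := by
      intro r hr
      have h2 : 2 ^ r ≤ Q ^ (r * (k - 2)) :=
        (Nat.pow_le_pow_left hQ r).trans
          (Nat.pow_le_pow_right (by omega) (Nat.le_mul_of_pos_right _ (by omega)))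
      have := Nat.mul_le_mul_left (Q ^ (2 * r) * (Q ^ (s + 1 - r)) ^ k) h2
      rw [hexp r hr] at this
      rw [one_div, inv_pow, ← div_eq_mul_inv, le_div_iff₀ (by positivity)]
      exact_mod_cast this
    have := Finset.sum_le_sum hterm
    rw [← Finset.mul_sum] at this
    have h2 := mul_le_mul_of_nonneg_left (sum_geometric_two_le (s + 1))
      (show (0 : ℝ) ≤ (Q : ℝ) ^ ((s + 1) * k) by positivity)
    have h3 := this.trans h2
    rw [mul_comm 2]
    exact_mod_cast h3

end Counting

section Bases

variable {L : Type*} [Field L] {V : Type*} [AddCommGroup V] [Module L V]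

theorem span_range_coe_eq_of_linearIndependent {k : ℕ} {W : Submodule L V} [FiniteDimensional L W]
    (hW : finrank L W = k) {h : Fin k → W} (hh : LinearIndependent L h) :
    Submodule.span L (Set.range fun i => (h i : V)) = W :=
  Submodule.eq_of_le_of_finrank_eq (Submodule.span_le.2 (by rintro _ ⟨i, rfl⟩; exact (h i).2))
    ((finrank_span_eq_card (hh.map' W.subtype W.ker_subtype)).trans
      ((Fintype.card_fin k).trans hW.symm))

/-- Counting linearly independent families of length `k` by grouping them by their span. -/
theorem card_linearIndependent_span [Fintype L] [Finite V] (k : ℕ) (P : Submodule L V → Prop) :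
    Nat.card {g : Fin k → V // LinearIndependent L g ∧ P (Submodule.span L (Set.range g))} =
      Set.ncard {W : Submodule L V | finrank L W = k ∧ P W} *
        ∏ i : Fin k, (Fintype.card L ^ k - Fintype.card L ^ (i : ℕ)) := by
  classical
  have : Fintype {W : Submodule L V // finrank L W = k ∧ P W} := Fintype.ofFinite _
  let f : (Σ W : {W : Submodule L V // finrank L W = k ∧ P W},
        {h : Fin k → W.1 // LinearIndependent L h}) →
      {g : Fin k → V // LinearIndependent L g ∧ P (Submodule.span L (Set.range g))} := fun x =>
    ⟨fun i => x.2.1 i, x.2.2.map' x.1.1.subtype x.1.1.ker_subtype,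
      (span_range_coe_eq_of_linearIndependent x.1.2.1 x.2.2).symm ▸ x.1.2.2⟩
  have hf : Function.Bijective f := by
    constructor
    · rintro ⟨⟨W, hW, hP⟩, h, hh⟩ ⟨⟨W', hW', hP'⟩, h', hh'⟩ he
      have he' : (fun i => (h i : V)) = fun i => (h' i : V) := congr_arg Subtype.val he
      obtain rfl : W = W' := by
        rw [← span_range_coe_eq_of_linearIndependent hW hh, he',
          span_range_coe_eq_of_linearIndependent hW' hh']
      obtain rfl : h = h' := funext fun i => Subtype.ext (congr_fun he' i)
      rfl
    · rintro ⟨g, hg, hP⟩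
      exact ⟨⟨⟨Submodule.span L (Set.range g),
        (finrank_span_eq_card hg).trans (Fintype.card_fin k), hP⟩,
        ⟨fun i => ⟨g i, Submodule.subset_span ⟨i, rfl⟩⟩,
          LinearIndependent.of_comp (Submodule.subtype _) hg⟩⟩, rfl⟩
  rw [← Nat.card_eq_of_bijective f hf, Nat.card_sigma]
  have : ∀ W : {W : Submodule L V // finrank L W = k ∧ P W},
      Nat.card {h : Fin k → W.1 // LinearIndependent L h} =
        ∏ i : Fin k, (Fintype.card L ^ k - Fintype.card L ^ (i : ℕ)) := by
    intro W
    rw [card_linearIndependent (le_of_eq W.2.1.symm), W.2.1]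
  simp only [this, Finset.sum_const, smul_eq_mul, Finset.card_univ]
  rw [← Nat.card_eq_fintype_card]
  rfl

end Bases
section Frobenius

variable (K : Type*) [Field K] [Fintype K] {L : Type*} [Field L] [Fintype L] [Algebra K L]

/-- The `i`-th power of the Frobenius automorphism of `L` over `K`. -/
noncomputable def frobPow (L : Type*) [Field L] [Fintype L] [Algebra K L] (i : ℕ) : L ≃ₐ[K] L :=
  FiniteField.frobeniusAlgEquivOfAlgebraic K L ^ i

theorem frobPow_apply (i : ℕ) (x : L) : frobPow K L i x = x ^ Fintype.card K ^ i := by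
  rw [frobPow, AlgEquiv.coe_pow, FiniteField.coe_frobeniusAlgEquivOfAlgebraic_iterate]

theorem frobPow_add (i j : ℕ) (x : L) : frobPow K L (i + j) x = frobPow K L i (frobPow K L j x) := by
  rw [frobPow, pow_add]; rfl

theorem frobV_eq_frobPow (i : ℕ) {n : ℕ} (v : Fin n → L) (l : Fin n) :
    frobV (Fintype.card K) i v l = frobPow K L i (v l) :=
  (frobPow_apply K i (v l)).symm

theorem frobCode_span_range {ι : Type*} {n : ℕ} (g : ι → Fin n → L) (i : ℕ) :
    frobCode (Fintype.card K) i (Submodule.span L (Set.range g)) =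
      Submodule.span L (Set.range fun j => frobV (Fintype.card K) i (g j)) := by
  apply le_antisymm
  · refine Submodule.span_le.2 ?_
    rintro _ ⟨x, hx, rfl⟩
    induction hx using Submodule.span_induction with
    | mem x h =>
      obtain ⟨j, rfl⟩ := h
      exact Submodule.subset_span ⟨j, rfl⟩
    | zero =>
      have : frobV (Fintype.card K) i (0 : Fin n → L) = 0 := by
        ext l
        simp [frobV_eq_frobPow]
      exact this.symm ▸ (Submodule.zero_mem _ : (0 : Fin n → L) ∈ _)
    | add x y _ _ hx hy =>
      have : frobV (Fintype.card K) i (x + y) =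
          frobV (Fintype.card K) i x + frobV (Fintype.card K) i y := by
        ext l
        simp [frobV_eq_frobPow]
      exact this ▸ Submodule.add_mem _ hx hy
    | smul c x _ hx =>
      have : frobV (Fintype.card K) i (c • x) =
          frobPow K L i c • frobV (Fintype.card K) i x := by
        ext l
        simp [frobV_eq_frobPow]
      exact this ▸ Submodule.smul_mem _ _ hx
  · refine Submodule.span_mono ?_
    rintro _ ⟨j, rfl⟩
    exact ⟨g j, Submodule.subset_span ⟨j, rfl⟩, rfl⟩

theorem iSup_frobCode_span_range {k n : ℕ} (g : Fin k → Fin n → L) (s : ℕ) :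
    ⨆ i ∈ Finset.range (s + 1), frobCode (Fintype.card K) i (Submodule.span L (Set.range g)) =
      Submodule.span L (Set.range fun p : Fin (s + 1) × Fin k =>
        frobV (Fintype.card K) p.1 (g p.2)) := by
  simp only [frobCode_span_range]
  apply le_antisymm
  · refine iSup₂_le fun i hi => Submodule.span_mono ?_
    rintro _ ⟨j, rfl⟩
    exact ⟨(⟨i, Finset.mem_range.1 hi⟩, j), rfl⟩
  · refine Submodule.span_le.2 ?_
    rintro _ ⟨p, rfl⟩
    exact Submodule.mem_iSup_of_mem (p.1 : ℕ) (Submodule.mem_iSup_of_mem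
      (Finset.mem_range.2 p.1.2) (Submodule.subset_span ⟨p.2, rfl⟩))

/-- The number of linear relations among `g`, in terms of the dimension of the span. -/
theorem card_relations {ι : Type*} [Fintype ι] {V : Type*} [AddCommGroup V] [Module L V]
    [FiniteDimensional L V] (v : ι → V) :
    Nat.card {c : ι → L // ∑ p, c p • v p = 0} =
      Fintype.card L ^ (Fintype.card ι - finrank L (Submodule.span L (Set.range v))) := by
  have h := (Fintype.linearCombination L v).finrank_range_add_finrank_ker
  rw [Fintype.range_linearCombination, finrank_fintype_fun_eq_card] at h
  rw [show Fintype.card ι - finrank L (Submodule.span L (Set.range v)) =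
    finrank L (Fintype.linearCombination L v).ker by omega, ← Nat.card_eq_fintype_card,
    ← Module.natCard_eq_pow_finrank]
  rfl

/-- The `K`-linear map `x ↦ ∑ c (i, j) x_j ^ q ^ i`. -/
noncomputable def qPolyMap {s k : ℕ} (c : Fin (s + 1) × Fin k → L) : (Fin k → L) →ₗ[K] L :=
  ∑ p, LinearMap.mulLeft K (c p) ∘ₗ (frobPow K L p.1).toLinearMap ∘ₗ LinearMap.proj p.2

theorem qPolyMap_apply {s k : ℕ} (c : Fin (s + 1) × Fin k → L) (x : Fin k → L) :
    qPolyMap K c x = ∑ p, c p * frobPow K L p.1 (x p.2) := by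
  simp [qPolyMap]

/-- The `K`-subspace of trace-orthogonal vectors to the image of `f`. -/
noncomputable def traceAnn {V : Type*} [AddCommGroup V] [Module K V] (f : V →ₗ[K] L) :
    Submodule K L :=
  (Algebra.traceForm K L).orthogonal f.range

theorem card_ker_mul_card {V : Type*} [AddCommGroup V] [Module K V] [Finite V] (f : V →ₗ[K] L) :
    Nat.card f.ker * Nat.card L = Nat.card V * Nat.card (traceAnn K f) := by
  have : FiniteDimensional K V := Module.Finite.of_finite
  have h1 := f.finrank_range_add_finrank_ker
  have h2 := LinearMap.BilinForm.finrank_orthogonal (traceForm_nondegenerate K L) f.range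
  have h3 := Submodule.finrank_le f.range
  rw [Module.natCard_eq_pow_finrank (K := K) (V := f.ker),
    Module.natCard_eq_pow_finrank (K := K) (V := L),
    Module.natCard_eq_pow_finrank (K := K) (V := V),
    Module.natCard_eq_pow_finrank (K := K) (V := traceAnn K f), ← pow_add, ← pow_add, traceAnn, h2]
  congr 1
  omega

/-- An element orthogonal to the image of a `q`-polynomial map is a root of its adjoint. -/
theorem sum_frobPow_eq_zero_of_mem_traceAnn {s k : ℕ} {c : Fin (s + 1) × Fin k → L} {b : L}
    (hb : b ∈ traceAnn K (qPolyMap K c)) (j : Fin k) :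
    ∑ i : Fin (s + 1), frobPow K L (s - i) (b * c (i, j)) = 0 := by
  classical
  refine (traceForm_nondegenerate K L).1 _ fun y => ?_
  obtain ⟨x, rfl⟩ := (frobPow K L s).surjective y
  have h := hb _ ⟨Pi.single j x, rfl⟩
  rw [Algebra.traceForm_apply, qPolyMap_apply,
    Fintype.sum_prod_type] at h
  rw [Algebra.traceForm_apply, ← h, Finset.sum_mul, Finset.sum_mul, map_sum, map_sum]
  refine Finset.sum_congr rfl fun i _ => ?_
  rw [Finset.sum_eq_single j (fun j' _ hj => by simp [Pi.single_eq_of_ne hj]) (by simp),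
    Pi.single_eq_same, ← Algebra.trace_eq_of_algEquiv (frobPow K L (s - i)) (c (i, j) * _ * b),
    map_mul (frobPow K L (s - i)), map_mul (frobPow K L (s - i)), map_mul (frobPow K L (s - i)),
    ← frobPow_add,
    show s - (i : ℕ) + i = s by have := i.2; omega]
  congr 1
  ring

/-- A `q`-polynomial of `q`-degree `< r` vanishing on an `r`-dimensional space is zero. -/
theorem eq_zero_of_sum_frobPow_eq_zero {s n r : ℕ} {b : Fin n → L}
    (hr : r ≤ finrank K (Submodule.span K (Set.range b))) {c : Fin (s + 1) → L}
    (hc : ∀ i : Fin (s + 1), (i : ℕ) < s + 1 - r → c i = 0)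
    (h : ∀ l, ∑ i : Fin (s + 1), frobPow K L (s - i) (b l * c i) = 0) : c = 0 := by
  classical
  set q := Fintype.card K
  have hq1 : 1 < q := Fintype.one_lt_card
  let p : L[X] := ∑ i : Fin (s + 1), C (c i ^ q ^ (s - (i : ℕ))) * X ^ q ^ (s - (i : ℕ))
  have heval : ∀ x, p.eval x = ∑ i : Fin (s + 1), frobPow K L (s - i) (x * c i) := by
    intro x
    simp only [p, eval_finsetSum, eval_mul, eval_C, eval_pow, eval_X, frobPow_apply, mul_pow]
    exact Finset.sum_congr rfl fun i _ => mul_comm _ _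
  have hvan : ∀ x ∈ Submodule.span K (Set.range b), p.eval x = 0 := by
    intro x hx
    rw [heval]
    induction hx using Submodule.span_induction with
    | mem x hx => obtain ⟨l, rfl⟩ := hx; exact h l
    | zero => simp
    | add x y _ _ hx hy => simp only [add_mul, map_add, Finset.sum_add_distrib, hx, hy, add_zero]
    | smul a x _ hx => simp only [smul_mul_assoc, map_smul, ← Finset.smul_sum, hx, smul_zero]
  have hdeg : p.natDegree < q ^ r := by
    have hpos : 0 < q ^ r := by positivity
    refine (natDegree_sum_le_of_forall_le (n := q ^ r - 1) _ _ fun i _ => ?_).trans_lt (by omega)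
    by_cases hi : (i : ℕ) < s + 1 - r
    · simp [hc i hi, zero_pow (pow_pos (Nat.zero_lt_of_lt hq1) _).ne']
    · refine (natDegree_C_mul_X_pow_le _ _).trans (Nat.le_sub_one_of_lt ?_)
      exact Nat.pow_lt_pow_right hq1 (by have := i.2; omega)
  have hp : p = 0 := by
    refine eq_zero_of_natDegree_lt_card_of_eval_eq_zero' p
      (Finset.univ.filter (· ∈ Submodule.span K (Set.range b))) (by simpa using hvan) ?_
    rw [← Fintype.card_subtype, Module.card_eq_pow_finrank (K := K)]
    exact hdeg.trans_le (Nat.pow_le_pow_right (by omega) hr)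
  funext i
  have hcoeff : p.coeff (q ^ (s - (i : ℕ))) = c i ^ q ^ (s - (i : ℕ)) := by
    simp only [p, finsetSum_coeff, coeff_C_mul_X_pow]
    rw [Finset.sum_eq_single i (fun j _ hj => if_neg fun he => hj ?_) (by simp), if_pos rfl]
    have := Nat.pow_right_injective hq1 he
    have := i.2
    have := j.2
    exact Fin.ext (by omega)
  rw [hp, coeff_zero] at hcoeff
  exact pow_eq_zero_iff (by positivity) |>.1 hcoeff.symm

theorem card_adjoint_roots_le {s k n : ℕ} (b : Fin n → L) :
    Nat.card {c : Fin (s + 1) × Fin k → L //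
      ∀ l j, ∑ i : Fin (s + 1), frobPow K L (s - i) (b l * c (i, j)) = 0} ≤
      (Fintype.card L ^ (s + 1 - finrank K (Submodule.span K (Set.range b)))) ^ k := by
  set r := finrank K (Submodule.span K (Set.range b))
  have hcard : Nat.card (Fin k → Fin (s + 1 - r) → L) = (Fintype.card L ^ (s + 1 - r)) ^ k := by
    simp
  rw [← hcard]
  refine Nat.card_le_card_of_injective (fun c j i => c.1 (Fin.castLE (by omega) i, j)) ?_
  rintro ⟨c, hc⟩ ⟨c', hc'⟩ h
  refine Subtype.ext (funext fun p => ?_)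
  have := eq_zero_of_sum_frobPow_eq_zero (K := K) (b := b) (s := s) le_rfl
    (c := fun i => c (i, p.2) - c' (i, p.2)) (fun i hi => sub_eq_zero.2
      (congr_fun (congr_fun h p.2) ⟨i, hi⟩)) (fun l => by
        simp only [mul_sub, map_sub, Finset.sum_sub_distrib, hc l p.2, hc' l p.2, sub_zero])
  exact sub_eq_zero.1 (congr_fun this p.1)

theorem card_finrank_span_eq_le (n r : ℕ) (hn : n ≤ finrank K L) :
    Nat.card {b : Fin n → L // finrank K (Submodule.span K (Set.range b)) = r} ≤
      Fintype.card L ^ (2 * r) := by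
  have hcard : Nat.card ((Fin r → L) × (Fin n → Fin r → K)) ≤ Fintype.card L ^ (2 * r) := by
    rw [Nat.card_prod, Nat.card_fun, Nat.card_fun, Nat.card_fun]
    simp only [Nat.card_eq_fintype_card, Fintype.card_fin]
    rw [two_mul, pow_add, ← pow_mul, mul_comm r n, pow_mul]
    refine Nat.mul_le_mul_left _ (Nat.pow_le_pow_left ?_ r)
    rw [Module.card_eq_pow_finrank (K := K) (V := L)]
    exact Nat.pow_le_pow_right Fintype.card_pos hn
  refine le_trans ?_ hcard
  let f : (Fin r → L) × (Fin n → Fin r → K) → Fin n → L := fun x l => ∑ t, x.2 l t • x.1 t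
  have hf : ∀ b : {b : Fin n → L // finrank K (Submodule.span K (Set.range b)) = r},
      ∃ x, f x = b.1 := by
    rintro ⟨b, hb⟩
    let e := finBasisOfFinrankEq K (Submodule.span K (Set.range b)) hb
    let y : Fin n → Submodule.span K (Set.range b) := fun l => ⟨b l, Submodule.subset_span ⟨l, rfl⟩⟩
    refine ⟨(fun t => e t, fun l t => e.repr (y l) t), funext fun l => ?_⟩
    have := congr_arg Subtype.val (e.sum_repr (y l))
    rw [Submodule.coe_sum] at this
    exact this
  choose x hx using hf
  exact Nat.card_le_card_of_injective x fun b b' h => Subtype.ext (by rw [← hx b, h, hx b'])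

end Frobenius
section FirstMoment

variable (K : Type*) [Field K] [Fintype K] {L : Type*} [Field L] [Fintype L] [Algebra K L]

theorem relation_iff_mem_ker {s k n : ℕ} (c : Fin (s + 1) × Fin k → L) (g : Fin k → Fin n → L) :
    ∑ p, c p • frobV (Fintype.card K) p.1 (g p.2) = 0 ↔
      ∀ l, (fun j => g j l) ∈ (qPolyMap K c).ker := by
  simp only [LinearMap.mem_ker, qPolyMap_apply, funext_iff, Finset.sum_apply, Pi.smul_apply,
    smul_eq_mul, frobV_eq_frobPow, Pi.zero_apply]

theorem card_families_with_relation {s k n : ℕ} (c : Fin (s + 1) × Fin k → L) :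
    Nat.card {g : Fin k → Fin n → L // ∑ p, c p • frobV (Fintype.card K) p.1 (g p.2) = 0} =
      Nat.card (qPolyMap K c).ker ^ n := by
  have h : Nat.card (Fin n → (qPolyMap K c).ker) = Nat.card (qPolyMap K c).ker ^ n := by
    rw [Nat.card_fun, Nat.card_fin]
  rw [← h]
  exact Nat.card_congr
    { toFun := fun g l => ⟨fun j => g.1 j l, (relation_iff_mem_ker K c g.1).1 g.2 l⟩
      invFun := fun x => ⟨fun j l => (x l).1 j, (relation_iff_mem_ker K c _).2 fun l => (x l).2⟩
      left_inv := fun _ => rfl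
      right_inv := fun _ => rfl }

theorem card_families_with_relation_mul {s k n : ℕ} (c : Fin (s + 1) × Fin k → L) :
    Nat.card {g : Fin k → Fin n → L // ∑ p, c p • frobV (Fintype.card K) p.1 (g p.2) = 0} *
      Fintype.card L ^ n =
      Fintype.card L ^ (k * n) *
        Nat.card {b : Fin n → L // ∀ l, b l ∈ traceAnn K (qPolyMap K c)} := by
  have h := card_ker_mul_card K (qPolyMap K c)
  have hb : Nat.card {b : Fin n → L // ∀ l, b l ∈ traceAnn K (qPolyMap K c)} =
      Nat.card (traceAnn K (qPolyMap K c)) ^ n := by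
    rw [Nat.card_congr (Equiv.subtypePiEquivPi
      (p := fun (_ : Fin n) x => x ∈ traceAnn K (qPolyMap K c)))]
    simp [Nat.card_pi]
  rw [Nat.card_eq_fintype_card (α := L)] at h
  rw [card_families_with_relation, hb, ← mul_pow, h, mul_pow, pow_mul]
  simp

theorem card_traceAnn_families_le {s k n : ℕ} (b : Fin n → L) :
    Nat.card {c : Fin (s + 1) × Fin k → L //
      c ≠ 0 ∧ ∀ l, b l ∈ traceAnn K (qPolyMap K c)} ≤
      ∑ r ∈ Finset.range (s + 1),
        if finrank K (Submodule.span K (Set.range b)) = r then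
          (Fintype.card L ^ (s + 1 - r)) ^ k else 0 := by
  have hle : Nat.card {c : Fin (s + 1) × Fin k → L //
      c ≠ 0 ∧ ∀ l, b l ∈ traceAnn K (qPolyMap K c)} ≤
      Nat.card {c : Fin (s + 1) × Fin k → L //
        ∀ l j, ∑ i : Fin (s + 1), frobPow K L (s - i) (b l * c (i, j)) = 0} :=
    Nat.card_le_card_of_injective
      (fun c => ⟨c.1, fun l => sum_frobPow_eq_zero_of_mem_traceAnn K (c.2.2 l)⟩)
      fun c c' h => Subtype.ext (Subtype.mk.inj h)
  rw [Finset.sum_ite_eq]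
  split_ifs with hr
  · exact hle.trans (card_adjoint_roots_le K b)
  · have hempty : IsEmpty {c : Fin (s + 1) × Fin k → L //
        c ≠ 0 ∧ ∀ l, b l ∈ traceAnn K (qPolyMap K c)} := by
      refine ⟨fun c => c.2.1 (funext fun p => ?_)⟩
      have hr' : s + 1 ≤ finrank K (Submodule.span K (Set.range b)) := by
        simpa using hr
      exact congr_fun (eq_zero_of_sum_frobPow_eq_zero K hr' (c := fun i => c.1 (i, p.2))
        (fun i hi => by omega)
        (fun l => sum_frobPow_eq_zero_of_mem_traceAnn K (c.2.2 l) p.2)) p.1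
    simp

/-- First moment bound for the number of nonzero relations among the Frobenius powers of the
rows of a random matrix. -/
theorem sum_card_relations_mul_le {s k n : ℕ} (hs : 1 ≤ s) (hsk : s < k) (hn : n ≤ finrank K L) :
    (∑ g : Fin k → Fin n → L, Nat.card {c : Fin (s + 1) × Fin k → L //
        c ≠ 0 ∧ ∑ p, c p • frobV (Fintype.card K) p.1 (g p.2) = 0}) * Fintype.card L ^ n ≤
      Fintype.card L ^ (k * n) * (2 * Fintype.card L ^ ((s + 1) * k)) := by
  classical
  rw [sum_card_subtype_comm, Finset.sum_mul]
  calc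
    _ ≤ ∑ c : Fin (s + 1) × Fin k → L, Fintype.card L ^ (k * n) *
          Nat.card {b : Fin n → L // c ≠ 0 ∧ ∀ l, b l ∈ traceAnn K (qPolyMap K c)} := by
      refine Finset.sum_le_sum fun c _ => ?_
      by_cases hc : c = 0
      · simp [hc]
      · simp only [ne_eq, hc, not_false_eq_true, true_and]
        exact (card_families_with_relation_mul K c).le
    _ = Fintype.card L ^ (k * n) * ∑ b : Fin n → L, Nat.card {c : Fin (s + 1) × Fin k → L //
          c ≠ 0 ∧ ∀ l, b l ∈ traceAnn K (qPolyMap K c)} := by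
      rw [← Finset.mul_sum, sum_card_subtype_comm]
    _ ≤ Fintype.card L ^ (k * n) * ∑ b : Fin n → L, ∑ r ∈ Finset.range (s + 1),
          if finrank K (Submodule.span K (Set.range b)) = r then
            (Fintype.card L ^ (s + 1 - r)) ^ k else 0 :=
      Nat.mul_le_mul_left _ (Finset.sum_le_sum fun b _ => card_traceAnn_families_le K b)
    _ = Fintype.card L ^ (k * n) * ∑ r ∈ Finset.range (s + 1),
          Nat.card {b : Fin n → L // finrank K (Submodule.span K (Set.range b)) = r} *
            (Fintype.card L ^ (s + 1 - r)) ^ k := by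
      rw [Finset.sum_comm]
      congr 1
      refine Finset.sum_congr rfl fun r _ => ?_
      rw [← Finset.sum_filter, Finset.sum_const, smul_eq_mul, Nat.card_eq_fintype_card,
        Fintype.card_subtype]
    _ ≤ _ := by
      refine Nat.mul_le_mul_left _ (le_trans (Finset.sum_le_sum fun r _ =>
        Nat.mul_le_mul_right _ (card_finrank_span_eq_le K n r hn)) ?_)
      exact sum_pow_mul_pow_le _ k s Fintype.one_lt_card hs hsk

/-- Markov's inequality applied to the number of nonzero relations. -/
theorem card_defect_families_mul_le {s k n d : ℕ} (hs : 1 ≤ s) (hsk : s < k)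
    (hn : n ≤ finrank K L) (hd : 1 ≤ d) (P : (Fin k → Fin n → L) → Prop)
    (hP : ∀ g, P g → finrank L (Submodule.span L (Set.range fun p : Fin (s + 1) × Fin k =>
      frobV (Fintype.card K) p.1 (g p.2))) + d ≤ (s + 1) * k) :
    Nat.card {g // P g} * Fintype.card L ^ (d + n) ≤
      4 * Fintype.card L ^ (k * n + (s + 1) * k) := by
  classical
  have hQ : 2 ≤ Fintype.card L := Fintype.one_lt_card
  have hpoint : ∀ g, (if P g then Fintype.card L ^ d else 0) ≤
      2 * Nat.card {c : Fin (s + 1) × Fin k → L //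
        c ≠ 0 ∧ ∑ p, c p • frobV (Fintype.card K) p.1 (g p.2) = 0} := by
    intro g
    split_ifs with hg
    · have h1 := card_relations (L := L) fun p : Fin (s + 1) × Fin k =>
        frobV (Fintype.card K) p.1 (g p.2)
      have h2 : Fintype.card L ^ d ≤ Nat.card {c : Fin (s + 1) × Fin k → L //
          ∑ p, c p • frobV (Fintype.card K) p.1 (g p.2) = 0} := by
        rw [h1, Fintype.card_prod, Fintype.card_fin, Fintype.card_fin]
        exact Nat.pow_le_pow_right (by omega) (by have := hP g hg; omega)
      have h3 : Nat.card {c : Fin (s + 1) × Fin k → L //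
          ∑ p, c p • frobV (Fintype.card K) p.1 (g p.2) = 0} ≤
          Nat.card {c : Fin (s + 1) × Fin k → L //
            c ≠ 0 ∧ ∑ p, c p • frobV (Fintype.card K) p.1 (g p.2) = 0} + 1 := by
        simp only [Nat.card_eq_fintype_card, Fintype.card_subtype]
        refine (Finset.card_le_card (t := insert 0 _) fun c hc => ?_).trans
          (Finset.card_insert_le _ _)
        by_cases h0 : c = 0
        · exact Finset.mem_insert.2 (Or.inl h0)
        · exact Finset.mem_insert.2 (Or.inr (by simpa [h0] using hc))
      have h4 : 2 ≤ Fintype.card L ^ d := hQ.trans (Nat.le_self_pow (by omega) _)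
      omega
    · exact Nat.zero_le _
  have hsum := Finset.sum_le_sum fun g (_ : g ∈ Finset.univ) => hpoint g
  rw [← Finset.sum_filter, Finset.sum_const, smul_eq_mul, ← Fintype.card_subtype,
    ← Nat.card_eq_fintype_card, ← Finset.mul_sum] at hsum
  have h := sum_card_relations_mul_le K (n := n) hs hsk hn
  calc
    _ = Nat.card {g // P g} * Fintype.card L ^ d * Fintype.card L ^ n := by rw [pow_add, mul_assoc]
    _ ≤ _ := Nat.mul_le_mul_right _ hsum
    _ ≤ 2 * (Fintype.card L ^ (k * n) * (2 * Fintype.card L ^ ((s + 1) * k))) := by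
      rw [mul_assoc]; exact Nat.mul_le_mul_left _ h
    _ = _ := by rw [pow_add]; ring

end FirstMoment

/-- For a uniformly random `k`-dimensional subspace `C_rand` of `F_{q^m}^n` with `s < k`,
`P(dim (C_rand + C_rand^{[1]} + ⋯ + C_rand^{[s]}) ≤ min(n, (s+1)k) - a) = O(q^{-ma})`,
with the implied constant independent of `m` and `a`. -/
theorem prob_dim_defect (K : Type) [Field K] [Fintype K] :
    ∃ C : ℝ, 0 < C ∧
      ∀ (L : Type) [Field L] [Fintype L] [Algebra K L] (n k s a : ℕ),
        1 ≤ s → s < k → k ≤ n → n ≤ Module.finrank K L →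
        (Set.ncard {W : Submodule L (Fin n → L) | Module.finrank L ↥W = k ∧
            Module.finrank L
              ↥(⨆ i ∈ Finset.range (s + 1), frobCode (Fintype.card K) i W)
              ≤ min n ((s + 1) * k) - a} : ℝ)
          / (Set.ncard {W : Submodule L (Fin n → L) | Module.finrank L ↥W = k} : ℝ)
        ≤ C * (Fintype.card K : ℝ) ^ (-((Module.finrank K L : ℤ) * a)) := by
  
  refine ⟨8, by norm_num, ?_⟩
  intro L _ _ _ n k s a hs hsk hkn hn
  have hQ : Fintype.card L = Fintype.card K ^ finrank K L := Module.card_eq_pow_finrank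
  have hzpow : (Fintype.card K : ℝ) ^ (-((finrank K L : ℤ) * a)) =
      ((Fintype.card L : ℝ) ^ a)⁻¹ := by
    rw [zpow_neg, zpow_mul, zpow_natCast, zpow_natCast, hQ]
    push_cast
    rfl
  have hQ4 : 3 ≤ Fintype.card L := by
    have h1 : 2 ≤ Fintype.card K := Fintype.one_lt_card
    have h2 : 2 ^ 2 ≤ Fintype.card K ^ finrank K L :=
      (Nat.pow_le_pow_left h1 2).trans (Nat.pow_le_pow_right (by omega) (by omega))
    omega
  rw [hzpow]
  rcases Nat.eq_zero_or_pos a with rfl | ha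
  · refine (div_le_one_of_le₀ ?_ (Nat.cast_nonneg _)).trans (by norm_num)
    exact_mod_cast Set.ncard_le_ncard (fun W (hW : _ ∧ _) => hW.1) (Set.toFinite _)
  set N := (s + 1) * k
  let D : Submodule L (Fin n → L) → Prop := fun W =>
    finrank L ↥(⨆ i ∈ Finset.range (s + 1), frobCode (Fintype.card K) i W) ≤ min n N - a
  have hbad := card_linearIndependent_span (L := L) k D
  have hall := card_linearIndependent_span (L := L) (V := Fin n → L) k fun _ => True
  simp only [and_true] at hall
  rw [card_linearIndependent (by simpa using hkn), finrank_fin_fun] at hall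
  set γ := ∏ i : Fin k, (Fintype.card L ^ k - Fintype.card L ^ (i : ℕ))
  have hγ : 0 < γ := Finset.prod_pos fun i _ =>
    Nat.sub_pos_of_lt (Nat.pow_lt_pow_right (by omega) i.2)
  have hmarkov := card_defect_families_mul_le K (n := n) (d := N - min n N + a) hs hsk hn (by omega)
    (fun g => LinearIndependent L g ∧ D (Submodule.span L (Set.range g))) (by
      rintro g ⟨hg, hD⟩
      have hle : finrank L ↥(⨆ i ∈ Finset.range (s + 1), frobCode (Fintype.card K) i
          (Submodule.span L (Set.range g))) ≤ min n N - a := hD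
      rw [iSup_frobCode_span_range] at hle
      have hpos : 1 ≤ finrank L (Submodule.span L (Set.range fun p : Fin (s + 1) × Fin k =>
          frobV (Fintype.card K) p.1 (g p.2))) := by
        refine Submodule.one_le_finrank_iff.2 fun hbot => hg.ne_zero ⟨0, by omega⟩ ?_
        rw [Submodule.span_eq_bot] at hbot
        have := hbot _ ⟨(0, ⟨0, by omega⟩), rfl⟩
        ext l
        simpa [frobV] using congr_fun this l
      omega)
  have hLI := pow_mul_le_two_mul_prod_sub (Fintype.card L) n k hQ4 hkn
  have hprod : ((∏ i : Fin k, (Fintype.card L ^ n - Fintype.card L ^ (i : ℕ)) : ℕ) : ℝ) =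
      ∏ i : Fin k, ((Fintype.card L : ℝ) ^ n - (Fintype.card L : ℝ) ^ (i : ℕ)) := by
    rw [Nat.cast_prod]
    refine Finset.prod_congr rfl fun i _ => ?_
    rw [Nat.cast_sub (Nat.pow_le_pow_right (by omega) (by have := i.2; omega))]
    push_cast
    rfl
  rw [← hprod, hall] at hLI
  have hLI' : Fintype.card L ^ (n * k) ≤
      2 * (Set.ncard {W : Submodule L (Fin n → L) | finrank L W = k} * γ) := by
    exact_mod_cast hLI
  rw [hbad] at hmarkov
  have hpos : 0 < Set.ncard {W : Submodule L (Fin n → L) | finrank L W = k} := by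
    refine Nat.pos_of_ne_zero fun h0 => ?_
    rw [h0, zero_mul, mul_zero] at hLI'
    exact absurd hLI' (Nat.not_le.2 (by positivity))
  set B := Set.ncard {W : Submodule L (Fin n → L) | finrank L W = k ∧ D W}
  set A := Set.ncard {W : Submodule L (Fin n → L) | finrank L W = k}
  have hmain : B * Fintype.card L ^ a ≤ 8 * A := by
    refine Nat.le_of_mul_le_mul_right (c := γ * Fintype.card L ^ N) ?_ (by positivity)
    calc
      _ = B * γ * Fintype.card L ^ (a + N) := by rw [pow_add]; ring
      _ ≤ B * γ * Fintype.card L ^ (N - min n N + a + n) :=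
        Nat.mul_le_mul_left _ (Nat.pow_le_pow_right (by omega) (by omega))
      _ ≤ 4 * Fintype.card L ^ (k * n + N) := hmarkov
      _ = 4 * (Fintype.card L ^ (n * k) * Fintype.card L ^ N) := by rw [pow_add, mul_comm k n]
      _ ≤ 4 * (2 * (A * γ) * Fintype.card L ^ N) :=
        Nat.mul_le_mul_left _ (Nat.mul_le_mul_right _ hLI')
      _ = _ := by ring
  have hmain' : (B : ℝ) * (Fintype.card L : ℝ) ^ a ≤ 8 * A := by exact_mod_cast hmain
  have hA0 : (0 : ℝ) < A := by exact_mod_cast hpos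
  have hQ0 : (0 : ℝ) < (Fintype.card L : ℝ) ^ a := by positivity
  change (B : ℝ) / A ≤ _
  rw [div_le_iff₀ hA0, ← div_eq_mul_inv, div_mul_eq_mul_div, le_div_iff₀ hQ0]
  exact hmain'
end

section
/- Let b ∈ F_{q^m}^n have F_q-linearly independent entries and k ≤ n ≤ m. Then the dual code Gab_k(b)^⊥ (with respect to the standard bilinear form Σ x_i y_i) is itself a Gabidulin code Gab_{n−k}(a) for some a ∈ F_{q^m}^n with F_q-linearly independent entries. -/
open Module Polynomial

theorem card_pow_sum {K L ι : Type*} [Field K] [Fintype K] [Field L] [Algebra K L]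
    (e : ℕ) (s : Finset ι) (f : ι → L) :
    (∑ i ∈ s, f i) ^ Fintype.card K ^ e = ∑ i ∈ s, f i ^ Fintype.card K ^ e := by
  have h (x : L) : ((FiniteField.frobeniusAlgHom K L) ^ e) x = x ^ Fintype.card K ^ e := by
    rw [AlgHom.coe_pow, FiniteField.coe_frobeniusAlgHom, pow_iterate]
  simp_rw [← h, map_sum]

theorem algebraMap_pow_card_pow {K L : Type*} [Field K] [Fintype K] [Field L] [Algebra K L]
    (e : ℕ) (x : K) : algebraMap K L x ^ Fintype.card K ^ e = algebraMap K L x := by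
  rw [← map_pow, FiniteField.pow_card_pow]

/-- A `q`-polynomial of `q`-degree `< r` vanishing on an `r`-dimensional space is zero. -/
theorem eq_zero_of_sum_pow_eq_zero {K L : Type*} [Field K] [Fintype K] [Field L] [Finite L]
    [Algebra K L] {r : ℕ} (c : Fin r → L) (W : Submodule K L) (hr : r ≤ finrank K W)
    (h : ∀ x ∈ W, ∑ j, c j * x ^ Fintype.card K ^ (j : ℕ) = 0) : c = 0 := by
  classical
  have hq : 1 < Fintype.card K := Fintype.one_lt_card
  set P : L[X] := ∑ j, C (c j) * X ^ Fintype.card K ^ (j : ℕ) with hP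
  have hdeg : P.degree < (Nat.card W : ℕ) := by
    rw [Module.natCard_eq_pow_finrank (K := K), Nat.card_eq_fintype_card]
    refine (degree_sum_le _ _).trans_lt ?_
    rw [Finset.sup_lt_iff (WithBot.bot_lt_coe _)]
    intro j _
    refine (degree_C_mul_X_pow_le _ _).trans_lt ?_
    exact_mod_cast Nat.pow_lt_pow_right hq (j.2.trans_le hr)
  have hP0 : P = 0 := by
    have : Fintype W := Fintype.ofFinite W
    refine eq_zero_of_degree_lt_of_eval_index_eq_zero (s := Finset.univ)
      (v := fun x : W => (x : L)) Subtype.val_injective.injOn ?_ ?_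
    · simpa [Nat.card_eq_fintype_card] using hdeg
    · intro x _
      simpa [hP, eval_finsetSum] using h x x.2
  funext j
  have := congrArg (fun p => coeff p (Fintype.card K ^ (j : ℕ))) hP0
  simpa [hP, finsetSum_coeff, coeff_C_mul, coeff_X_pow, Nat.pow_right_inj hq,
    Fin.val_inj] using this

theorem linearIndependent_frobV {K L : Type*} [Field K] [Fintype K] [Field L] [Finite L]
    [Algebra K L] {n r : ℕ} (hr : r ≤ n) {b : Fin n → L} (hb : LinearIndependent K b) :
    LinearIndependent L (fun j : Fin r => frobV (Fintype.card K) j b) := by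
  rw [Fintype.linearIndependent_iff]
  intro c hc
  refine congrFun (eq_zero_of_sum_pow_eq_zero (K := K) c (Submodule.span K (Set.range b)) ?_ ?_)
  · rwa [finrank_span_eq_card hb, Fintype.card_fin]
  · intro x hx
    obtain ⟨μ, rfl⟩ := (Submodule.mem_span_range_iff_exists_fun K).1 hx
    simp_rw [card_pow_sum, Algebra.smul_def, mul_pow, algebraMap_pow_card_pow, Finset.mul_sum]
    rw [Finset.sum_comm]
    refine Finset.sum_eq_zero fun i _ => ?_
    have := congrFun hc i
    simp only [Finset.sum_apply, Pi.smul_apply, smul_eq_mul, frobV, Pi.zero_apply] at this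
    simp_rw [mul_left_comm _ (algebraMap K L (μ i)), ← Finset.mul_sum, this, mul_zero]

/-- A nonzero vector over the base field is not a codeword of `Gab_{n-1}(b)`. -/
theorem algebraMap_comp_notMem_span_frobV {K L : Type*} [Field K] [Fintype K] [Field L]
    [Finite L] [Algebra K L] {r : ℕ} {b : Fin (r + 1) → L} (hb : LinearIndependent K b)
    {l : Fin (r + 1) → K} (hl : l ≠ 0) :
    (fun i => algebraMap K L (l i)) ∉
      Submodule.span L (Set.range fun j : Fin r => frobV (Fintype.card K) j b) := by
  intro hmem
  obtain ⟨c, hc⟩ := (Submodule.mem_span_range_iff_exists_fun L).1 hmem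
  have hc' (i : Fin (r + 1)) :
      ∑ j, c j * b i ^ Fintype.card K ^ (j : ℕ) = algebraMap K L (l i) := by
    simpa [frobV] using congrFun hc i
  have hc0 : c = 0 := by
    refine eq_zero_of_sum_pow_eq_zero (K := K) c
      ((LinearMap.ker (Fintype.linearCombination K l)).map (Fintype.linearCombination K b)) ?_ ?_
    · rw [← (Submodule.equivMapOfInjective _ hb.fintypeLinearCombination_injective _).finrank_eq]
      have h1 := (Fintype.linearCombination K l).finrank_range_add_finrank_ker
      have h2 := Submodule.finrank_le (LinearMap.range (Fintype.linearCombination K l))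
      simp only [finrank_self, finrank_fintype_fun_eq_card, Fintype.card_fin] at h1 h2
      omega
    · rintro _ ⟨μ, hμ, rfl⟩
      have hμ' : ∑ i, μ i * l i = 0 := by
        simpa [Fintype.linearCombination_apply] using hμ
      simp_rw [Fintype.linearCombination_apply, card_pow_sum, Algebra.smul_def, mul_pow,
        algebraMap_pow_card_pow, Finset.mul_sum]
      rw [Finset.sum_comm]
      simp_rw [mul_left_comm _ (algebraMap K L (μ _)), ← Finset.mul_sum, hc', ← map_mul,
        ← map_sum, hμ', map_zero]
  refine hl (funext fun i => ?_)
  simpa [hc0] using (hc' i).symm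

theorem finrank_ker_mulVecLin_of {L : Type*} [Field L] {n r : ℕ} {v : Fin r → Fin n → L}
    (hv : LinearIndependent L v) :
    r + finrank L (LinearMap.ker (Matrix.of v).mulVecLin) = n := by
  have h := (Matrix.of v).mulVecLin.finrank_range_add_finrank_ker
  have h' : (Matrix.of v).rank = r := by
    simpa using LinearIndependent.rank_matrix (M := Matrix.of v) hv
  rw [Matrix.rank] at h'
  simpa [h'] using h

theorem gab_eq_span_range {L : Type*} [Field L] (q k : ℕ) {n : ℕ} (a : Fin n → L) :
    gab q k a = Submodule.span L (Set.range fun j : Fin k => frobV q j a) := by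
  rw [gab]
  congr 1
  ext v
  constructor
  · rintro ⟨j, hj, rfl⟩
    exact ⟨⟨j, hj⟩, rfl⟩
  · rintro ⟨j, rfl⟩
    exact ⟨j, j.2, rfl⟩

theorem dualCode_gab_eq_ker {L : Type*} [Field L] (q k : ℕ) {n : ℕ} (b : Fin n → L) :
    dualCode (gab q k b) =
      LinearMap.ker (Matrix.of fun j : Fin k => frobV q j b).mulVecLin := by
  ext x
  rw [gab_eq_span_range, LinearMap.mem_ker, Matrix.mulVecLin_apply]
  constructor
  · intro hx
    funext j
    rw [Matrix.mulVec, dotProduct_comm]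
    exact hx _ (Submodule.subset_span ⟨j, rfl⟩)
  · intro hx c hc
    change x ⬝ᵥ c = 0
    induction hc using Submodule.span_induction with
    | mem _ h =>
      obtain ⟨j, rfl⟩ := h
      rw [dotProduct_comm]
      exact congrFun hx j
    | zero => simp
    | add _ _ _ _ hy hz => rw [dotProduct_add, hy, hz, add_zero]
    | smul t _ _ hy => rw [dotProduct_smul, hy, smul_zero]

/-- If `a` is independent and its first `n - k` Frobenius powers are orthogonal to the first `k`
Frobenius powers of `b`, then `Gab_{n-k}(a)` is the dual of `Gab_k(b)`. -/
theorem dualCode_gab_eq_gab {K L : Type*} [Field K] [Fintype K] [Field L] [Finite L]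
    [Algebra K L] {n k : ℕ} (hk : k ≤ n) {a b : Fin n → L} (ha : LinearIndependent K a)
    (hb : LinearIndependent K b)
    (h : ∀ t < n - k, ∀ j < k,
      ∑ i, a i ^ Fintype.card K ^ t * b i ^ Fintype.card K ^ j = 0) :
    dualCode (gab (Fintype.card K) k b) = gab (Fintype.card K) (n - k) a := by
  symm
  apply Submodule.eq_of_le_of_finrank_eq
  · rw [gab_eq_span_range, dualCode_gab_eq_ker, Submodule.span_le]
    rintro _ ⟨t, rfl⟩
    rw [SetLike.mem_coe, LinearMap.mem_ker, Matrix.mulVecLin_apply]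
    funext j
    rw [Matrix.mulVec, dotProduct_comm]
    exact h t t.2 j j.2
  · have hd := finrank_ker_mulVecLin_of (linearIndependent_frobV hk hb)
    rw [gab_eq_span_range, dualCode_gab_eq_ker,
      finrank_span_eq_card (linearIndependent_frobV (Nat.sub_le n k) ha), Fintype.card_fin]
    omega

theorem LinearIndependent.frobV {K L : Type*} [Field K] [Fintype K] [Field L] [Algebra K L]
    {n : ℕ} {a : Fin n → L} (ha : LinearIndependent K a) (s : ℕ) :
    LinearIndependent K (frobV (Fintype.card K) s a) := by
  rw [Fintype.linearIndependent_iff] at ha ⊢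
  intro g hg
  refine ha g (pow_eq_zero_iff (pow_ne_zero s (Fintype.card_ne_zero (α := K))) |>.1 ?_)
  rw [card_pow_sum (K := K), ← hg]
  simp_rw [Algebra.smul_def, mul_pow, algebraMap_pow_card_pow, _root_.frobV]

/-- The dual of `Gab_{n-1}(b)` contains a vector with independent entries. -/
theorem exists_linearIndependent_orthogonal {K L : Type*} [Field K] [Fintype K] [Field L]
    [Finite L] [Algebra K L] {r : ℕ} {b : Fin (r + 1) → L} (hb : LinearIndependent K b) :
    ∃ h : Fin (r + 1) → L, LinearIndependent K h ∧
      ∀ j < r, ∑ i, h i * b i ^ Fintype.card K ^ j = 0 := by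
  have hv := linearIndependent_frobV (Nat.le_succ r) hb
  have hd := finrank_ker_mulVecLin_of hv
  obtain ⟨h, hker, h0⟩ := Submodule.exists_mem_ne_zero_of_ne_bot
    (p := LinearMap.ker (Matrix.of fun j : Fin r => frobV (Fintype.card K) j b).mulVecLin)
    (by intro hbot; rw [hbot, finrank_bot] at hd; omega)
  rw [LinearMap.mem_ker, Matrix.mulVecLin_apply] at hker
  refine ⟨h, ?_, fun j hj => ?_⟩
  · rw [Fintype.linearIndependent_iff]
    intro l hl
    by_contra! hne
    have hl0 : l ≠ 0 := fun e => by simp [e] at hne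
    have hind := linearIndependent_finCons.2
      ⟨hv, algebraMap_comp_notMem_span_frobV hb hl0⟩
    have hd' := finrank_ker_mulVecLin_of hind
    refine h0 ((Submodule.eq_bot_iff _).1
      (Submodule.finrank_eq_zero.1 (Nat.add_left_cancel hd')) h ?_)
    rw [LinearMap.mem_ker, Matrix.mulVecLin_apply]
    funext j
    refine Fin.cases ?_ (fun j => ?_) j
    · simpa [Matrix.mulVec, dotProduct, Algebra.smul_def] using hl
    · exact congrFun hker j
  · simpa [Matrix.mulVec, dotProduct, frobV, mul_comm] using congrFun hker ⟨j, hj⟩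

/-- The dual of a Gabidulin code is a Gabidulin code:
`Gab_k(b)^⊥ = Gab_{n-k}(a)` for some `a` with `F_q`-linearly independent entries. -/
theorem dual_gab_is_gab {K L : Type*} [Field K] [Fintype K] [Field L] [Fintype L]
    [Algebra K L] (n k : ℕ) (hk : k ≤ n) (hn : n ≤ Module.finrank K L)
    (b : Fin n → L) (hb : LinearIndependent K b) :
    ∃ a : Fin n → L, LinearIndependent K a ∧
      dualCode (gab (Fintype.card K) k b) = gab (Fintype.card K) (n - k) a := by
  rcases hk.eq_or_lt with rfl | hlt
  · exact ⟨b, hb, dualCode_gab_eq_gab le_rfl hb hb (by simp)⟩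
  obtain ⟨r, rfl⟩ := Nat.exists_eq_add_one_of_ne_zero (Nat.ne_zero_of_lt hlt)
  obtain ⟨h, hh, horth⟩ := exists_linearIndependent_orthogonal hb
  have hm : 1 ≤ finrank K L := by omega
  refine ⟨frobV (Fintype.card K) ((r - k) * (finrank K L - 1)) h, hh.frobV _,
    dualCode_gab_eq_gab (K := K) hk (hh.frobV _) hb fun t ht j hj => ?_⟩
  have hback (x : L) : ((x ^ Fintype.card K ^ ((r - k) * (finrank K L - 1))) ^
      Fintype.card K ^ t) ^ Fintype.card K ^ (r - k - t) = x := by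
    have hexp : (r - k) * (finrank K L - 1) + t + (r - k - t) = finrank K L * (r - k) := by
      obtain ⟨m, hm'⟩ := Nat.exists_eq_add_of_le' hm
      rw [hm', Nat.add_sub_cancel, add_assoc, Nat.add_sub_of_le (by omega)]
      ring
    rw [← pow_mul, ← pow_mul, ← pow_add, ← pow_add, ← add_assoc, hexp, pow_mul,
      ← Module.card_eq_pow_finrank (K := K) (V := L), FiniteField.pow_card_pow]
  refine pow_eq_zero_iff
    (pow_ne_zero (r - k - t) (Fintype.card_ne_zero (α := K))) |>.1 ?_
  rw [card_pow_sum (K := K), ← horth (j + (r - k - t)) (by omega)]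
  refine Finset.sum_congr rfl fun i _ => ?_
  rw [mul_pow, frobV, hback, ← pow_mul, ← pow_add]
end
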